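/- For p ∈ [1,∞), OT_p is a metric on M^p: it is symmetric, satisfies the triangle inequality, and OT_p(μ,ν) = 0 implies μ = ν. -/

import Mathlib

noncomputable section

open MeasureTheory Metric Set Filter Topology ENNReal
open scoped Classical

/-- The plane with the Euclidean distance. -/
abbrev Pt : Type := EuclideanSpace ℝ (Fin 2)

/-- Build a point of the plane from coordinates. -/
def mk2 (a b : ℝ) : Pt := (WithLp.equiv 2 (Fin 2 → ℝ)).symm ![a, b]

/-- The open upper half-plane Ω = {(t₁,t₂) : t₂ > t₁}. -/
def UHP : Set Pt := {x | x 0 < x 1}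

/-- The diagonal ∂Ω = {(t,t)}. -/
def Diag : Set Pt := {x | x 0 = x 1}

/-- Ω̄ = Ω ∪ ∂Ω. -/
def UHPbar : Set Pt := UHP ∪ Diag

/-- Distance from a point to the diagonal. -/
def persDist (x : Pt) : ℝ := infDist x Diag

/-- p-th total persistence Pers_p(μ) = ∫_Ω d(x,∂Ω)^p dμ(x). -/
def Pers (p : ℝ) (μ : Measure Pt) : ℝ≥0∞ :=
  ∫⁻ x in UHP, ENNReal.ofReal (persDist x ^ p) ∂μ

/-- μ ∈ M^p : a measure supported on Ω with finite p-th persistence. -/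
def MemMp (p : ℝ) (μ : Measure Pt) : Prop := μ UHPᶜ = 0 ∧ Pers p μ < ⊤

/-- Admissible partial transport plans between μ and ν: measures on Ω̄ × Ω̄ whose
marginals restricted to Ω are μ and ν. -/
def Adm (μ ν : Measure Pt) : Set (Measure (Pt × Pt)) :=
  {π | π ((UHPbar ×ˢ UHPbar)ᶜ) = 0 ∧
    (∀ A : Set Pt, MeasurableSet A → A ⊆ UHP → π (A ×ˢ univ) = μ A) ∧
    (∀ B : Set Pt, MeasurableSet B → B ⊆ UHP → π (univ ×ˢ B) = ν B)}

/-- Cost C_p(π) = ∬ d(x,y)^p dπ(x,y). -/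
def Cost (p : ℝ) (π : Measure (Pt × Pt)) : ℝ≥0∞ :=
  ∫⁻ z, ENNReal.ofReal (dist z.1 z.2 ^ p) ∂π

/-- OT_p(μ,ν)^p, as an extended real. -/
def OTe (p : ℝ) (μ ν : Measure Pt) : ℝ≥0∞ := ⨅ π ∈ Adm μ ν, Cost p π

/-- The optimal partial transport distance OT_p(μ,ν). -/
def OT (p : ℝ) (μ ν : Measure Pt) : ℝ := (OTe p μ ν ^ (1 / p)).toReal

/-- Optimal plans. -/
def OptSet (p : ℝ) (μ ν : Measure Pt) : Set (Measure (Pt × Pt)) :=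
  {π | π ∈ Adm μ ν ∧ Cost p π = OTe p μ ν}

/-- Vague convergence of measures on Ω: convergence of integrals of continuous
functions compactly supported in Ω. -/
def VagueTendsto (μs : ℕ → Measure Pt) (μ : Measure Pt) : Prop :=
  ∀ f : Pt → ℝ, Continuous f → HasCompactSupport f → tsupport f ⊆ UHP →
    Tendsto (fun n => ∫ x, f x ∂(μs n)) atTop (𝓝 (∫ x, f x ∂μ))

/-- E_Ω = (Ω̄ × Ω̄) \ (∂Ω × ∂Ω). -/
def EOm : Set (Pt × Pt) := (UHPbar ×ˢ UHPbar) \ (Diag ×ˢ Diag)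

/-- Vague convergence of plans on E_Ω. -/
def VaguePlanTendsto (πs : ℕ → Measure (Pt × Pt)) (π : Measure (Pt × Pt)) : Prop :=
  ∀ f : Pt × Pt → ℝ, Continuous f → HasCompactSupport f → tsupport f ⊆ EOm →
    Tendsto (fun n => ∫ z, f z ∂(πs n)) atTop (𝓝 (∫ z, f z ∂π))

/-- A persistence diagram: an ℕ-valued point measure Σ_{x ∈ X} n_x δ_x with
X ⊆ Ω locally finite in Ω. -/
def IsDiagram (μ : Measure Pt) : Prop :=
  ∃ (X : Set Pt) (n : Pt → ℕ), X ⊆ UHP ∧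
    (∀ x ∈ UHP, ∃ U ∈ 𝓝 x, (X ∩ U).Finite) ∧
    μ = Measure.sum (fun x : X => (n x.1 : ℝ≥0∞) • Measure.dirac (x.1 : Pt))

/-- Support of a measure on Pt × Pt. -/
def msupp (π : Measure (Pt × Pt)) : Set (Pt × Pt) := {z | ∀ U ∈ 𝓝 z, π U ≠ 0}

/-- Support of a measure on Pt. -/
def suppM (μ : Measure Pt) : Set Pt := {x | ∀ U ∈ 𝓝 x, μ U ≠ 0}

/-- Bottleneck cost of a plan: sup of d(x,y) over the support. -/
def CostInf (π : Measure (Pt × Pt)) : ℝ≥0∞ :=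
  ⨆ z ∈ msupp π, ENNReal.ofReal (dist z.1 z.2)

/-- The bottleneck (∞) optimal partial transport distance, as extended real. -/
def OTinfE (μ ν : Measure Pt) : ℝ≥0∞ := ⨅ π ∈ Adm μ ν, CostInf π

/-- μ ∈ M^∞ : support at bounded distance from the diagonal. -/
def MemMinf (μ : Measure Pt) : Prop :=
  μ UHPᶜ = 0 ∧ ∃ C : ℝ, ∀ x ∈ suppM μ, persDist x ≤ C

/-- A partial matching between two indexed families: a bijection between
subsets of the index sets; unmatched points are sent to the diagonal. -/
structure Matching (ι κ : Type*) where
  I : Set ι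
  J : Set κ
  e : I ≃ J

/-- Cost of a partial matching for d_p (as the p-th power, extended real). -/
def mCost (p : ℝ) {ι κ : Type*} (x : ι → Pt) (y : κ → Pt) (m : Matching ι κ) : ℝ≥0∞ :=
  (∑' i : m.I, ENNReal.ofReal (dist (x i.1) (y (m.e i).1) ^ p))
  + (∑' i : ↥(m.Iᶜ), ENNReal.ofReal (persDist (x i.1) ^ p))
  + (∑' j : ↥(m.Jᶜ), ENNReal.ofReal (persDist (y j.1) ^ p))

/-- Bottleneck cost of a partial matching. -/
def mCostInf {ι κ : Type*} (x : ι → Pt) (y : κ → Pt) (m : Matching ι κ) : ℝ≥0∞ :=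
  (⨆ i : m.I, ENNReal.ofReal (dist (x i.1) (y (m.e i).1)))
  ⊔ (⨆ i : ↥(m.Iᶜ), ENNReal.ofReal (persDist (x i.1)))
  ⊔ (⨆ j : ↥(m.Jᶜ), ENNReal.ofReal (persDist (y j.1)))

/-- The point measure associated to an indexed family of points. -/
def famMeasure {ι : Type*} (x : ι → Pt) : Measure Pt :=
  Measure.sum (fun i => Measure.dirac (x i))

/-- The weighted measure μ^p, with density d(x,∂Ω)^p with respect to μ. -/
def wgt (p : ℝ) (μ : Measure Pt) : Measure Pt :=
  μ.withDensity (fun x => ENNReal.ofReal (persDist x ^ p))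

/-- The quotient space Ω̃ = Ω ⊔ {∂Ω}. -/
def Qt : Type := Option ↥UHP

/-- The quotient metric ρ on Ω̃. -/
def ρQ : Qt → Qt → ℝ
  | some x, some y => min (dist (x : Pt) (y : Pt)) (persDist x + persDist y)
  | some x, none => persDist x
  | none, some y => persDist y
  | none, none => 0

/-- The quotient metric ρ viewed on the plane, all diagonal points being
identified. -/
def ρP (x y : Pt) : ℝ :=
  if x ∈ Diag then (if y ∈ Diag then 0 else persDist y)
  else if y ∈ Diag then persDist x
  else min (dist x y) (persDist x + persDist y)

/-- Couplings with full (equal-mass) marginals. -/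
def Coup (μ ν : Measure Pt) : Set (Measure (Pt × Pt)) :=
  {π | π.map Prod.fst = μ ∧ π.map Prod.snd = ν}

/-- The p-Wasserstein distance (to the p) for the quotient metric ρ. -/
def WpE (p : ℝ) (μ ν : Measure Pt) : ℝ≥0∞ :=
  ⨅ π ∈ Coup μ ν, ∫⁻ z, ENNReal.ofReal (ρP z.1 z.2 ^ p) ∂π



open ProbabilityTheory

lemma glue_finite (α β : Measure (Pt × Pt)) [IsFiniteMeasure α] [IsFiniteMeasure β]
    (h : α.fst = β.fst) : ∃ γ : Measure (Pt × (Pt × Pt)),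
      γ.map (fun t => (t.1, t.2.1)) = α ∧ γ.map (fun t => (t.1, t.2.2)) = β := by
  refine ⟨α.fst ⊗ₘ (α.condKernel ×ₖ β.condKernel), ?_, ?_⟩
  · have := Measure.compProd_map (μ := α.fst) (κ := α.condKernel ×ₖ β.condKernel)
      (f := Prod.fst) measurable_fst
    rw [← Kernel.fst_eq, Kernel.fst_prod, α.disintegrate] at this
    exact this.symm
  · have := Measure.compProd_map (μ := α.fst) (κ := α.condKernel ×ₖ β.condKernel)
      (f := Prod.snd) measurable_snd
    rw [← Kernel.snd_eq, Kernel.snd_prod, h, β.disintegrate, ← h] at this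
    exact this.symm

lemma glue (ν : Measure Pt) [SigmaFinite ν] (α β : Measure (Pt × Pt))
    (hα : α.fst = ν) (hβ : β.fst = ν) : ∃ γ : Measure (Pt × (Pt × Pt)),
      γ.map (fun t => (t.1, t.2.1)) = α ∧ γ.map (fun t => (t.1, t.2.2)) = β := by
  let B : ℕ → Set Pt := disjointed (spanningSets ν)
  have hBm : ∀ n, MeasurableSet (B n) := MeasurableSet.disjointed (measurableSet_spanningSets ν)
  have hBf : ∀ n, ν (B n) < ⊤ := fun n =>
    (measure_mono (disjointed_le _ n)).trans_lt (measure_spanningSets_lt_top ν n)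
  have hBu : ⋃ n, B n = univ := by
    rw [iUnion_disjointed, iUnion_spanningSets]
  have hBd : Pairwise (Function.onFun Disjoint B) := disjoint_disjointed _
  have key : ∀ (α : Measure (Pt × Pt)), α.fst = ν →
      (∀ n, IsFiniteMeasure (α.restrict (Prod.fst ⁻¹' B n))) ∧
      (∀ n, (α.restrict (Prod.fst ⁻¹' B n)).fst = ν.restrict (B n)) ∧
      Measure.sum (fun n => α.restrict (Prod.fst ⁻¹' B n)) = α := by
    intro α hα
    refine ⟨fun n => ⟨?_⟩, fun n => ?_, ?_⟩
    · rw [Measure.restrict_apply_univ, ← Measure.fst_apply (hBm n), hα]; exact hBf n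
    · rw [← hα, Measure.fst, Measure.fst, Measure.restrict_map measurable_fst (hBm n)]
    · rw [← Measure.restrict_iUnion, ← preimage_iUnion, hBu, preimage_univ, Measure.restrict_univ]
      · intro i j hij
        exact (hBd hij).preimage _
      · exact fun n => measurable_fst (hBm n)
  obtain ⟨a1, a2, a3⟩ := key α hα
  obtain ⟨b1, b2, b3⟩ := key β hβ
  choose γ h1 h2 using fun n => glue_finite (α.restrict (Prod.fst ⁻¹' B n))
    (β.restrict (Prod.fst ⁻¹' B n)) ((a2 n).trans (b2 n).symm)
  refine ⟨Measure.sum γ, ?_, ?_⟩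
  · rw [Measure.map_sum (by fun_prop)]
    simp_rw [h1]; exact a3
  · rw [Measure.map_sum (by fun_prop)]
    simp_rw [h2]; exact b3

lemma isOpen_UHP : IsOpen UHP := isOpen_lt (by fun_prop) (by fun_prop)
lemma isClosed_Diag : IsClosed Diag := isClosed_eq (by fun_prop) (by fun_prop)
lemma meas_UHP : MeasurableSet UHP := isOpen_UHP.measurableSet
lemma meas_Diag : MeasurableSet Diag := isClosed_Diag.measurableSet
lemma disj_UD : Disjoint UHP Diag := by
  rw [Set.disjoint_left]; intro x h1 h2; exact h1.ne h2

lemma Diag_nonempty : Diag.Nonempty := ⟨0, by simp [Diag]⟩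

lemma persDist_pos {x : Pt} (hx : x ∈ UHP) : 0 < persDist x :=
  (isClosed_Diag.notMem_iff_infDist_pos Diag_nonempty).1 (Set.disjoint_left.1 disj_UD hx)

lemma persDist_cont : Continuous persDist := continuous_infDist_pt _

lemma restrict_UHP {μ : Measure Pt} (h : μ UHPᶜ = 0) : μ.restrict UHP = μ := by
  apply Measure.restrict_eq_self_of_ae_mem
  exact h

lemma fin_level {p : ℝ} (hp : 1 ≤ p) {μ : Measure Pt} (hμ : MemMp p μ) {ε : ℝ} (hε : 0 < ε) :
    μ {x | ε ≤ persDist x} < ⊤ := by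
  have hP := hμ.2
  rw [Pers, restrict_UHP hμ.1] at hP
  have hm : Measurable (fun x => ENNReal.ofReal (persDist x ^ p)) :=
    ((persDist_cont.rpow_const (fun _ => Or.inr (by linarith))).measurable).ennreal_ofReal
  have h0 : ENNReal.ofReal (ε ^ p) ≠ 0 := by
    simpa using Real.rpow_pos_of_pos hε p
  have h := meas_ge_le_lintegral_div (μ := μ) hm.aemeasurable h0 (by simp)
  refine (measure_mono ?_).trans_lt (h.trans_lt (ENNReal.div_lt_top hP.ne h0))
  intro x hx
  exact ENNReal.ofReal_le_ofReal (Real.rpow_le_rpow hε.le hx (by linarith))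

lemma level_cover {x : Pt} (hx : x ∈ UHP) : ∃ n : ℕ, 1 / ((n : ℝ) + 1) ≤ persDist x := by
  obtain ⟨n, hn⟩ := exists_nat_one_div_lt (persDist_pos hx)
  exact ⟨n, hn.le⟩

lemma sigmaFinite_of_mem {p : ℝ} (hp : 1 ≤ p) {μ : Measure Pt} (hμ : MemMp p μ) :
    SigmaFinite μ := by
  refine ⟨⟨⟨fun n => UHPᶜ ∪ {x | 1 / ((n : ℝ) + 1) ≤ persDist x}, fun _ => trivial, fun n => ?_, ?_⟩⟩⟩
  · refine (measure_union_le _ _).trans_lt ?_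
    rw [hμ.1, zero_add]
    exact fin_level hp hμ (by positivity)
  · rw [eq_univ_iff_forall]
    intro x
    by_cases hx : x ∈ UHP
    · obtain ⟨n, hn⟩ := level_cover hx
      exact mem_iUnion.2 ⟨n, Or.inr hn⟩
    · exact mem_iUnion.2 ⟨0, Or.inl hx⟩

lemma cost_meas (p : ℝ) (hp : 1 ≤ p) : Measurable
    (fun z : Pt × Pt => ENNReal.ofReal (dist z.1 z.2 ^ p)) :=
  ((continuous_dist.rpow_const (fun _ => Or.inr (by linarith))).measurable).ennreal_ofReal

/-- swapping plans -/
lemma adm_swap {μ ν : Measure Pt} {π : Measure (Pt × Pt)} (h : π ∈ Adm μ ν) :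
    π.map Prod.swap ∈ Adm ν μ := by
  obtain ⟨h0, h1, h2⟩ := h
  have hb : MeasurableSet UHPbar := meas_UHP.union meas_Diag
  refine ⟨?_, fun A hA hAU => ?_, fun A hA hAU => ?_⟩
  · rw [Measure.map_apply measurable_swap (hb.prod hb).compl, preimage_compl, preimage_swap_prod, h0]
  · rw [Measure.map_apply measurable_swap (hA.prod .univ), preimage_swap_prod, h2 A hA hAU]
  · rw [Measure.map_apply measurable_swap (MeasurableSet.univ.prod hA), preimage_swap_prod, h1 A hA hAU]

lemma cost_swap {p : ℝ} (hp : 1 ≤ p) (π : Measure (Pt × Pt)) :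
    Cost p (π.map Prod.swap) = Cost p π := by
  rw [Cost, lintegral_map (cost_meas p hp) measurable_swap]
  simp [Cost, dist_comm]

lemma OTe_symm_le {p : ℝ} (hp : 1 ≤ p) (μ ν : Measure Pt) : OTe p μ ν ≤ OTe p ν μ := by
  refine le_iInf₂ fun π hπ => ?_
  rw [← cost_swap hp]
  exact iInf₂_le _ (adm_swap hπ)

lemma OTe_symm {p : ℝ} (hp : 1 ≤ p) (μ ν : Measure Pt) : OTe p μ ν = OTe p ν μ :=
  le_antisymm (OTe_symm_le hp _ _) (OTe_symm_le hp _ _)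

/-- projection to the diagonal -/
def prj (x : Pt) : Pt := !₂[(x 0 + x 1) / 2, (x 0 + x 1) / 2]

lemma prj_mem (x : Pt) : prj x ∈ Diag := by simp [prj, Diag]

lemma prj_cont : Continuous prj := by
  unfold prj
  fun_prop

lemma dist_prj (x : Pt) : dist x (prj x) ≤ persDist x := by
  refine (le_infDist Diag_nonempty).2 fun y hy => ?_
  have hy : y 0 = y 1 := hy
  rw [EuclideanSpace.dist_eq, EuclideanSpace.dist_eq]
  apply Real.sqrt_le_sqrt
  simp only [Fin.sum_univ_two, Real.dist_eq, sq_abs, prj]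
  simp
  rw [← hy]
  nlinarith [sq_nonneg (x 0 + x 1 - 2 * y 0)]

lemma OTe_ne_top {p : ℝ} (hp : 1 ≤ p) {μ ν : Measure Pt} (hμ : MemMp p μ) (hν : MemMp p ν) :
    OTe p μ ν ≠ ⊤ := by
  have hb : MeasurableSet UHPbar := meas_UHP.union meas_Diag
  have m1 : Measurable (fun x : Pt => (x, prj x)) := measurable_id.prodMk prj_cont.measurable
  have m2 : Measurable (fun x : Pt => (prj x, x)) := prj_cont.measurable.prodMk measurable_id
  have hc : ∀ x, ENNReal.ofReal (dist x (prj x) ^ p) ≤ ENNReal.ofReal (persDist x ^ p) := fun x =>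
    ENNReal.ofReal_le_ofReal (Real.rpow_le_rpow dist_nonneg (dist_prj x) (by linarith))
  have hPμ := hμ.2
  have hPν := hν.2
  rw [Pers, restrict_UHP hμ.1] at hPμ
  rw [Pers, restrict_UHP hν.1] at hPν
  have hno : ∀ A : Set Pt, A ⊆ UHP → prj ⁻¹' A = ∅ := fun A hA => by
    ext x
    simp only [mem_preimage, mem_empty_iff_false, iff_false]
    exact fun h => Set.disjoint_left.1 disj_UD (hA h) (prj_mem x)
  refine ne_top_of_le_ne_top (b := Cost p (μ.map (fun x => (x, prj x)) + ν.map (fun x => (prj x, x))))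
    ?_ (iInf₂_le _ ⟨?_, fun A hA hAU => ?_, fun A hA hAU => ?_⟩)
  · rw [Cost, lintegral_add_measure, lintegral_map (cost_meas p hp) m1,
      lintegral_map (cost_meas p hp) m2]
    refine (ENNReal.add_lt_top.2 ⟨?_, ?_⟩).ne
    · exact (lintegral_mono hc).trans_lt hPμ
    · simp_rw [dist_comm (prj _)]
      exact (lintegral_mono hc).trans_lt hPν
  · rw [Measure.add_apply, Measure.map_apply m1 (hb.prod hb).compl,
      Measure.map_apply m2 (hb.prod hb).compl, add_eq_zero]
    constructor
    · refine measure_mono_null ?_ hμ.1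
      intro x hx hxU
      exact hx ⟨Or.inl hxU, Or.inr (prj_mem x)⟩
    · refine measure_mono_null ?_ hν.1
      intro x hx hxU
      exact hx ⟨Or.inr (prj_mem x), Or.inl hxU⟩
  · rw [Measure.add_apply, Measure.map_apply m1 (hA.prod .univ),
      Measure.map_apply m2 (hA.prod .univ), mk_preimage_prod, mk_preimage_prod, hno A hAU]
    simp
  · rw [Measure.add_apply, Measure.map_apply m1 (MeasurableSet.univ.prod hA),
      Measure.map_apply m2 (MeasurableSet.univ.prod hA), mk_preimage_prod, mk_preimage_prod, hno A hAU]
    simp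

/-- zero distance -/
lemma closed_le {p : ℝ} (hp : 1 ≤ p) {μ ν : Measure Pt} (hν : MemMp p ν)
    (h : OTe p μ ν = 0) {ε : ℝ} (hε : 0 < ε) {F : Set Pt} (hF : IsClosed F)
    (hFU : F ⊆ UHP) (hFε : ∀ x ∈ F, ε ≤ persDist x) : μ F ≤ ν F := by
  have hb : MeasurableSet UHPbar := meas_UHP.union meas_Diag
  have hsub : ∀ δ, δ < ε / 2 → ∀ x ∈ cthickening δ F, ε / 2 ≤ persDist x := by
    intro δ hδ x hx
    have h1 := cthickening_subset_thickening' (by linarith) hδ F hx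
    obtain ⟨z, hz, hxz⟩ := mem_thickening_iff.1 h1
    have h2 := hFε z hz
    have h3 : infDist z Diag ≤ infDist x Diag + dist z x := infDist_le_infDist_add_dist
    rw [dist_comm] at h3
    unfold persDist at *
    linarith
  have hT := tendsto_measure_cthickening_of_isClosed (μ := ν) (s := F)
    ⟨ε / 4, by linarith, ((measure_mono (hsub (ε / 4) (by linarith))).trans_lt
      (fin_level hp hν (half_pos hε))).ne⟩ hF
  have hT' : Tendsto (fun r => ν (cthickening r F)) (𝓝[>] 0) (𝓝 (ν F)) :=
    hT.mono_left nhdsWithin_le_nhds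
  refine ge_of_tendsto hT' ?_
  filter_upwards [self_mem_nhdsWithin, nhdsWithin_le_nhds (Iio_mem_nhds (half_pos hε))] with δ hδ hδε
  have hδ : 0 < δ := hδ
  have hc0 : ENNReal.ofReal (δ ^ p) ≠ 0 := by
    simpa using Real.rpow_pos_of_pos hδ p
  have hpi : ∀ π ∈ Adm μ ν, μ F ≤ ν (cthickening δ F) + Cost p π / ENNReal.ofReal (δ ^ p) := by
    intro π ⟨h0, h1, h2⟩
    rw [← h1 F hF.measurableSet hFU]
    have hsub2 : F ×ˢ univ ⊆ (univ ×ˢ (cthickening δ F ∩ UHP) ∪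
        {z : Pt × Pt | ENNReal.ofReal (δ ^ p) ≤ ENNReal.ofReal (dist z.1 z.2 ^ p)}) ∪
        (UHPbar ×ˢ UHPbar)ᶜ := by
      rintro ⟨x, y⟩ ⟨hx, -⟩
      by_cases hxy : δ ≤ dist x y
      · exact Or.inl (Or.inr (ENNReal.ofReal_le_ofReal
          (Real.rpow_le_rpow hδ.le hxy (by linarith))))
      · have hyc : y ∈ cthickening δ F :=
          mem_cthickening_of_dist_le y x δ F hx (by rw [dist_comm]; exact (not_le.1 hxy).le)
        by_cases hyU : y ∈ UHP
        · exact Or.inl (Or.inl ⟨trivial, hyc, hyU⟩)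
        · refine Or.inr fun hh => ?_
          rcases hh.2 with h3 | h3
          · exact hyU h3
          · have h4 := hsub δ hδε y hyc
            have h5 : persDist y = 0 := infDist_zero_of_mem h3
            linarith
    refine (measure_mono hsub2).trans ((measure_union_le _ _).trans ?_)
    rw [h0, add_zero]
    refine (measure_union_le _ _).trans (add_le_add ?_ ?_)
    · rw [h2 _ (isClosed_cthickening.measurableSet.inter meas_UHP) inter_subset_right]
      exact measure_mono inter_subset_left
    · exact meas_ge_le_lintegral_div (cost_meas p hp).aemeasurable hc0 (by simp)
  refine ENNReal.le_of_forall_pos_le_add fun η hη _ => ?_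
  have hlt : OTe p μ ν < η * ENNReal.ofReal (δ ^ p) := by
    rw [h]
    exact ENNReal.mul_pos (by simpa using hη.ne') hc0
  obtain ⟨π, hπ⟩ := iInf_lt_iff.1 hlt
  obtain ⟨hπA, hπ⟩ := iInf_lt_iff.1 hπ
  refine (hpi π hπA).trans (add_le_add le_rfl ?_)
  exact ENNReal.div_le_of_le_mul hπ.le

lemma eq_of_zero {p : ℝ} (hp : 1 ≤ p) {μ ν : Measure Pt} (hμ : MemMp p μ) (hν : MemMp p ν)
    (h : OTe p μ ν = 0) : μ = ν := by
  let L : ℕ → Set Pt := fun n => {x | 1 / ((n : ℝ) + 1) ≤ persDist x} ∩ {x | x 0 ≤ x 1}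
  have hLc : ∀ n, IsClosed (L n) := fun n =>
    (isClosed_le continuous_const persDist_cont).inter (isClosed_le (by fun_prop) (by fun_prop))
  have hLU : ∀ n, L n ⊆ UHP := by
    rintro n x ⟨h1, h2⟩
    rcases lt_or_eq_of_le (show x 0 ≤ x 1 from h2) with h3 | h3
    · exact h3
    · have h5 : persDist x = 0 := infDist_zero_of_mem h3
      have h1 : 1 / ((n : ℝ) + 1) ≤ persDist x := h1
      have : 0 < 1 / ((n : ℝ) + 1) := by positivity
      linarith
  have hpos : ∀ n : ℕ, 0 < 1 / ((n : ℝ) + 1) := fun n => by positivity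
  have hLun : ⋃ n, L n = UHP := by
    refine Subset.antisymm (iUnion_subset hLU) fun x hx => ?_
    obtain ⟨n, hn⟩ := level_cover hx
    exact mem_iUnion.2 ⟨n, hn, show x 0 ≤ x 1 from le_of_lt hx⟩
  have hcl : ∀ n, ∀ F, IsClosed F → μ (F ∩ L n) = ν (F ∩ L n) := by
    intro n F hF
    refine le_antisymm ?_ ?_
    · exact closed_le hp hν h (hpos n) (hF.inter (hLc n))
        (inter_subset_right.trans (hLU n)) (fun x hx => hx.2.1)
    · exact closed_le hp hμ (by rw [OTe_symm hp, h]) (hpos n) (hF.inter (hLc n))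
        (inter_subset_right.trans (hLU n)) (fun x hx => hx.2.1)
  rw [← restrict_UHP hμ.1, ← restrict_UHP hν.1, ← hLun, Measure.restrict_iUnion_congr]
  intro n
  have : IsFiniteMeasure (μ.restrict (L n)) := ⟨by
    rw [Measure.restrict_apply_univ]
    exact (measure_mono inter_subset_left).trans_lt (fin_level hp hμ (hpos n))⟩
  refine ext_of_generate_finite {s | IsClosed s} ?_ isPiSystem_isClosed ?_ ?_
  · rw [BorelSpace.measurable_eq (α := Pt), borel_eq_generateFrom_isClosed]
  · intro F hF
    rw [Measure.restrict_apply hF.measurableSet, Measure.restrict_apply hF.measurableSet]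
    exact hcl n F hF
  · rw [Measure.restrict_apply_univ, Measure.restrict_apply_univ]
    simpa using hcl n univ isClosed_univ

lemma tri_plan {p : ℝ} (hp : 1 ≤ p) {μ ν ξ : Measure Pt} (hν : MemMp p ν)
    {π₁ π₂ : Measure (Pt × Pt)} (h₁ : π₁ ∈ Adm μ ν) (h₂ : π₂ ∈ Adm ν ξ) :
    ∃ π ∈ Adm μ ξ, Cost p π ^ (1 / p) ≤ Cost p π₁ ^ (1 / p) + Cost p π₂ ^ (1 / p) := by
  have hb : MeasurableSet UHPbar := meas_UHP.union meas_Diag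
  have := sigmaFinite_of_mem hp hν
  obtain ⟨h10, h11, h12⟩ := h₁
  obtain ⟨h20, h21, h22⟩ := h₂
  have hU := meas_UHP
  have hD := meas_Diag
  let α := (π₁.restrict (univ ×ˢ UHP)).map Prod.swap
  let β := π₂.restrict (UHP ×ˢ univ)
  have hνU : ∀ A : Set Pt, ν (A ∩ UHP) = ν A := fun A =>
    measure_inter_conull hν.1
  have hα : α.fst = ν := by
    ext A hA
    rw [Measure.fst_apply hA, Measure.map_apply measurable_swap (measurable_fst hA),
      Measure.restrict_apply (measurable_swap (measurable_fst hA)), ← hνU A,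
      ← h12 _ (hA.inter hU) inter_subset_right]
    congr 1
    ext ⟨x, y⟩
    simp
  have hβ : β.fst = ν := by
    ext A hA
    rw [Measure.fst_apply hA, Measure.restrict_apply (measurable_fst hA), ← hνU A,
      ← h21 _ (hA.inter hU) inter_subset_right]
    congr 1
    ext ⟨x, y⟩
    simp
  obtain ⟨γ, hγ1, hγ2⟩ := glue ν α β hα hβ
  -- coordinates (y, (x, z))
  let Γ : Measure (Pt × (Pt × Pt)) := γ
    + (π₁.restrict (UHP ×ˢ Diag)).map (fun w => (w.2, (w.1, w.2)))
    + (π₂.restrict (Diag ×ˢ UHP)).map (fun w => (w.1, (w.1, w.2)))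
  have hG1 : Γ.map (fun t => (t.2.1, t.1)) = π₁.restrict (univ ×ˢ UHP) + π₁.restrict (UHP ×ˢ Diag)
      + (π₂.restrict (Diag ×ˢ UHP)).map (fun w => (w.1, w.1)) := by
    simp only [Γ]
    rw [Measure.map_add _ _ (by fun_prop), Measure.map_add _ _ (by fun_prop),
      Measure.map_map (by fun_prop) (by fun_prop), Measure.map_map (by fun_prop) (by fun_prop)]
    have e : γ.map (fun t => (t.2.1, t.1)) = π₁.restrict (univ ×ˢ UHP) := by
      have := congrArg (Measure.map Prod.swap) hγ1
      rw [Measure.map_map measurable_swap (by fun_prop),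
        Measure.map_map measurable_swap measurable_swap, Prod.swap_swap_eq, Measure.map_id] at this
      exact this
    rw [e]
    congr 2
    exact Measure.map_id
  have hG2 : Γ.map (fun t => (t.1, t.2.2)) = π₂.restrict (UHP ×ˢ univ)
      + (π₁.restrict (UHP ×ˢ Diag)).map (fun w => (w.2, w.2)) + π₂.restrict (Diag ×ˢ UHP) := by
    simp only [Γ]
    rw [Measure.map_add _ _ (by fun_prop), Measure.map_add _ _ (by fun_prop),
      Measure.map_map (by fun_prop) (by fun_prop), Measure.map_map (by fun_prop) (by fun_prop), hγ2]
    congr 1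
    exact Measure.map_id
  have c1 : ∫⁻ t, ENNReal.ofReal (dist t.2.1 t.1 ^ p) ∂Γ ≤ Cost p π₁ := by
    have e := lintegral_map (μ := Γ) (cost_meas p hp)
      (show Measurable (fun t : Pt × (Pt × Pt) => (t.2.1, t.1)) by fun_prop)
    rw [← e, hG1, lintegral_add_measure, lintegral_map (cost_meas p hp) (by fun_prop)]
    simp only [dist_self, Real.zero_rpow (show p ≠ 0 by linarith), ENNReal.ofReal_zero,
      lintegral_zero, add_zero]
    rw [← Measure.restrict_union _ (hU.prod hD)]
    · exact lintegral_mono' Measure.restrict_le_self le_rfl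
    · exact Set.disjoint_prod.2 (Or.inr disj_UD)
  have c2 : ∫⁻ t, ENNReal.ofReal (dist t.1 t.2.2 ^ p) ∂Γ ≤ Cost p π₂ := by
    have e := lintegral_map (μ := Γ) (cost_meas p hp)
      (show Measurable (fun t : Pt × (Pt × Pt) => (t.1, t.2.2)) by fun_prop)
    rw [← e, hG2, lintegral_add_measure, lintegral_add_measure,
      lintegral_map (cost_meas p hp) (by fun_prop)]
    simp only [dist_self, Real.zero_rpow (show p ≠ 0 by linarith), ENNReal.ofReal_zero,
      lintegral_zero, add_zero]
    rw [← lintegral_add_measure, ← Measure.restrict_union _ (hD.prod hU)]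
    · exact lintegral_mono' Measure.restrict_le_self le_rfl
    · exact Set.disjoint_prod.2 (Or.inl disj_UD)
  have mxz : Measurable (fun t : Pt × (Pt × Pt) => t.2) := measurable_snd
  have fst_marg : ∀ A, MeasurableSet A → Γ {t | t.2.1 ∈ A} = π₁ (A ×ˢ UHP) +
      π₁ ((A ∩ UHP) ×ˢ Diag) + π₂ ((A ∩ Diag) ×ˢ UHP) := by
    intro A hA
    have e := congrArg (fun m => m (A ×ˢ univ)) hG1
    have mm : MeasurableSet (A ×ˢ (univ : Set Pt)) := hA.prod .univ
    simp only [Measure.add_apply] at e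
    rw [Measure.map_apply (by fun_prop) mm, Measure.map_apply (by fun_prop) mm,
      Measure.restrict_apply mm, Measure.restrict_apply mm,
      Measure.restrict_apply ((show Measurable (fun w : Pt × Pt => (w.1, w.1)) by fun_prop) mm)] at e
    convert e using 2
    · ext t; simp
    · congr 2
      · ext ⟨x, y⟩; simp
      · ext ⟨x, y⟩; simp; tauto
    · congr 1; ext ⟨x, y⟩; simp; tauto
  have snd_marg : ∀ A, MeasurableSet A → Γ {t | t.2.2 ∈ A} = π₂ (UHP ×ˢ A) +
      π₁ (UHP ×ˢ (A ∩ Diag)) + π₂ (Diag ×ˢ (A ∩ UHP)) := by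
    intro A hA
    have e := congrArg (fun m => m (univ ×ˢ A)) hG2
    have mm : MeasurableSet ((univ : Set Pt) ×ˢ A) := MeasurableSet.univ.prod hA
    simp only [Measure.add_apply] at e
    rw [Measure.map_apply (by fun_prop) mm, Measure.map_apply (by fun_prop) mm,
      Measure.restrict_apply mm, Measure.restrict_apply mm,
      Measure.restrict_apply ((show Measurable (fun w : Pt × Pt => (w.2, w.2)) by fun_prop) mm)] at e
    convert e using 2
    · ext t; simp
    · congr 2
      · ext ⟨x, y⟩; simp; tauto
      · ext ⟨x, y⟩; simp; tauto
    · congr 1; ext ⟨x, y⟩; simp; tauto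
  have hdb : Disjoint (UHPbarᶜ) UHP ∧ Disjoint (UHPbarᶜ) Diag :=
    ⟨disjoint_compl_left_iff_subset.2 subset_union_left,
      disjoint_compl_left_iff_subset.2 subset_union_right⟩
  refine ⟨Γ.map (fun t => t.2), ⟨?_, fun A hA hAU => ?_, fun A hA hAU => ?_⟩, ?_⟩
  · rw [Measure.map_apply mxz (hb.prod hb).compl]
    refine measure_mono_null (t := {t | t.2.1 ∈ UHPbarᶜ} ∪ {t | t.2.2 ∈ UHPbarᶜ}) ?_ ?_
    · intro t ht
      by_contra hc
      simp only [mem_union, not_or, mem_setOf_eq, mem_compl_iff, not_not] at hc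
      exact ht ⟨hc.1, hc.2⟩
    · rw [measure_union_null_iff, fst_marg _ hb.compl, snd_marg _ hb.compl,
        hdb.1.inter_eq, hdb.2.inter_eq]
      simp only [empty_prod, prod_empty, measure_empty, add_zero]
      constructor
      · refine measure_mono_null ?_ h10
        exact fun z hz hz' => hz.1 hz'.1
      · refine measure_mono_null ?_ h20
        exact fun z hz hz' => hz.2 hz'.2
  · rw [Measure.map_apply mxz (hA.prod .univ)]
    have e : (fun t : Pt × (Pt × Pt) => t.2) ⁻¹' (A ×ˢ univ) = {t | t.2.1 ∈ A} := by
      ext t; simp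
    rw [e, fst_marg A hA, (disj_UD.mono_left hAU).inter_eq, inter_eq_left.2 hAU, empty_prod,
      measure_empty, add_zero, ← measure_union (Set.disjoint_prod.2 (Or.inr disj_UD)) (hA.prod hD),
      ← prod_union, ← h11 A hA hAU]
    refine le_antisymm (measure_mono (prod_mono le_rfl (subset_univ _))) ?_
    refine (measure_mono (t := A ×ˢ (UHP ∪ Diag) ∪ (UHPbar ×ˢ UHPbar)ᶜ) ?_).trans
      ((measure_union_le _ _).trans (by rw [h10, add_zero]))
    intro z hz
    by_cases hzb : z ∈ UHPbar ×ˢ UHPbar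
    · exact Or.inl ⟨hz.1, hzb.2⟩
    · exact Or.inr hzb
  · rw [Measure.map_apply mxz (MeasurableSet.univ.prod hA)]
    have e : (fun t : Pt × (Pt × Pt) => t.2) ⁻¹' (univ ×ˢ A) = {t | t.2.2 ∈ A} := by
      ext t; simp
    rw [e, snd_marg A hA, (disj_UD.mono_left hAU).inter_eq, inter_eq_left.2 hAU, prod_empty,
      measure_empty, add_zero, ← measure_union (Set.disjoint_prod.2 (Or.inl disj_UD)) (hD.prod hA),
      ← union_prod, ← h22 A hA hAU]
    refine le_antisymm (measure_mono (prod_mono (subset_univ _) le_rfl)) ?_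
    refine (measure_mono (t := (UHP ∪ Diag) ×ˢ A ∪ (UHPbar ×ˢ UHPbar)ᶜ) ?_).trans
      ((measure_union_le _ _).trans (by rw [h20, add_zero]))
    intro z hz
    by_cases hzb : z ∈ UHPbar ×ˢ UHPbar
    · exact Or.inl ⟨hzb.1, hz.2⟩
    · exact Or.inr hzb
  · have hp0 : 0 ≤ p := by linarith
    have hq : 0 ≤ 1 / p := by positivity
    rw [Cost, lintegral_map (cost_meas p hp) mxz]
    have hM := ENNReal.lintegral_Lp_add_le (μ := Γ) (p := p)
      (f := fun t => ENNReal.ofReal (dist t.2.1 t.1)) (g := fun t => ENNReal.ofReal (dist t.1 t.2.2))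
      (by fun_prop) (by fun_prop) hp
    simp only [Pi.add_apply, ENNReal.ofReal_rpow_of_nonneg dist_nonneg hp0] at hM
    refine le_trans (ENNReal.rpow_le_rpow (lintegral_mono fun t => ?_) hq)
      (hM.trans (add_le_add (ENNReal.rpow_le_rpow c1 hq) (ENNReal.rpow_le_rpow c2 hq)))
    rw [← ENNReal.ofReal_rpow_of_nonneg dist_nonneg hp0, ← ENNReal.ofReal_add dist_nonneg dist_nonneg]
    exact ENNReal.rpow_le_rpow (ENNReal.ofReal_le_ofReal (dist_triangle _ _ _)) hp0

lemma OTe_rpow {p : ℝ} (hp : 1 ≤ p) (μ ν : Measure Pt) :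
    OTe p μ ν ^ (1 / p) = ⨅ π : Adm μ ν, Cost p π.1 ^ (1 / p) := by
  have hq : 0 < 1 / p := by positivity
  have := (ENNReal.orderIsoRpow (1 / p) hq).map_iInf (fun π : Adm μ ν => Cost p π.1)
  simp only [ENNReal.orderIsoRpow_apply] at this
  rw [← this, OTe, iInf_subtype]

lemma OTe_tri {p : ℝ} (hp : 1 ≤ p) {μ ν ξ : Measure Pt} (hν : MemMp p ν) :
    OTe p μ ξ ^ (1 / p) ≤ OTe p μ ν ^ (1 / p) + OTe p ν ξ ^ (1 / p) := by
  rw [OTe_rpow hp μ ν, OTe_rpow hp ν ξ, ENNReal.iInf_add]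
  refine le_iInf fun π₁ => ?_
  rw [ENNReal.add_iInf]
  refine le_iInf fun π₂ => ?_
  obtain ⟨π, hπ, h⟩ := tri_plan hp hν π₁.2 π₂.2
  refine le_trans (ENNReal.rpow_le_rpow (iInf₂_le π hπ) (by positivity)) h

/-- OT_p is a metric on M^p. -/
theorem stmt2 (p : ℝ) (hp : 1 ≤ p) (μ ν ξ : Measure Pt)
    (hμ : MemMp p μ) (hν : MemMp p ν) (hξ : MemMp p ξ) :
    OT p μ ν = OT p ν μ ∧
    OT p μ ξ ≤ OT p μ ν + OT p ν ξ ∧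
    (OT p μ ν = 0 → μ = ν) := by
  have hq : 0 ≤ 1 / p := by positivity
  have hfin : ∀ {μ ν : Measure Pt}, MemMp p μ → MemMp p ν → OTe p μ ν ^ (1 / p) ≠ ⊤ :=
    fun h1 h2 => ENNReal.rpow_ne_top_of_nonneg hq (OTe_ne_top hp h1 h2)
  refine ⟨?_, ?_, fun h => ?_⟩
  · rw [OT, OT, OTe_symm hp]
  · rw [OT, OT, OT, ← ENNReal.toReal_add (hfin hμ hν) (hfin hν hξ)]
    exact ENNReal.toReal_mono (ENNReal.add_ne_top.2 ⟨hfin hμ hν, hfin hν hξ⟩) (OTe_tri hp hν)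
  · rw [OT, ENNReal.toReal_eq_zero_iff] at h
    have h := h.resolve_right (hfin hμ hν)
    have hp0 : 0 < 1 / p := by positivity
    exact eq_of_zero hp hμ hν ((ENNReal.rpow_eq_zero_iff_of_pos hp0).1 h)
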